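/- If T is a tree with at least 3 vertices and H is a connected graph with at least 2 vertices, then μt(T □ H) = μt(T) · μt(H). -/

import Mathlib

open SimpleGraph

/-- `X` is a total mutual-visibility set of `G`: every pair of vertices `x, y` admits a
shortest `x,y`-path whose vertices in `X` are among `{x, y}`. -/
def IsTotalMVSet {V : Type*} (G : SimpleGraph V) (X : Set V) : Prop :=
  ∀ x y : V, ∃ p : G.Walk x y, p.IsPath ∧ p.length = G.dist x y ∧
    ∀ z ∈ p.support, z ∈ X → z = x ∨ z = y

/-- The total mutual-visibility number of `G`. -/
noncomputable def totalMVNum {V : Type*} (G : SimpleGraph V) : ℕ :=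
  sSup {n : ℕ | ∃ X : Set V, IsTotalMVSet G X ∧ X.ncard = n}

/-- `S` is an independent set of `G`. -/
def IsIndepVSet {V : Type*} (G : SimpleGraph V) (S : Set V) : Prop :=
  ∀ x ∈ S, ∀ y ∈ S, ¬ G.Adj x y

/-- The independent total mutual-visibility number of `G`. -/
noncomputable def indepTotalMVNum {V : Type*} (G : SimpleGraph V) : ℕ :=
  sSup {n : ℕ | ∃ X : Set V, IsTotalMVSet G X ∧ IsIndepVSet G X ∧ X.ncard = n}

/-- `u` is a bypass vertex of `G` if it is not the middle vertex of a convex path of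
length 2, i.e. there are no vertices `x ≠ y` with `x, y` nonadjacent and `u` their unique
common neighbour. -/
def IsBypassVertex {V : Type*} (G : SimpleGraph V) (u : V) : Prop :=
  ¬ ∃ x y : V, x ≠ y ∧ ¬ G.Adj x y ∧ G.Adj x u ∧ G.Adj u y ∧
      ∀ w : V, G.Adj x w → G.Adj w y → w = u

/-- The number of bypass vertices of `G`. -/
noncomputable def bpNum {V : Type*} (G : SimpleGraph V) : ℕ :=
  {u : V | IsBypassVertex G u}.ncard

section

variable {V W : Type*} {G : SimpleGraph V} {H : SimpleGraph W}

theorem IsTotalMVSet.ncard_le_totalMVNum [Finite V] {X : Set V} (hX : IsTotalMVSet G X) :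
    X.ncard ≤ totalMVNum G := by
  refine le_csSup ⟨Nat.card V, ?_⟩ ⟨X, hX, rfl⟩
  rintro _ ⟨Y, -, rfl⟩
  exact Set.ncard_le_card Y

theorem isTotalMVSet_empty (hG : G.Connected) : IsTotalMVSet G ∅ := fun x y => by
  obtain ⟨p, hp, hd⟩ := hG.exists_path_of_dist x y
  exact ⟨p, hp, hd, by simp⟩

theorem exists_isTotalMVSet_ncard_eq [Finite V] (hG : G.Connected) :
    ∃ X : Set V, IsTotalMVSet G X ∧ X.ncard = totalMVNum G := by
  refine Nat.sSup_mem (s := {n | ∃ X : Set V, IsTotalMVSet G X ∧ X.ncard = n})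
    ⟨_, ∅, isTotalMVSet_empty hG, rfl⟩ ⟨Nat.card V, ?_⟩
  rintro _ ⟨Y, -, rfl⟩
  exact Set.ncard_le_card Y

/-- A walk in a box product projects to walks in the two factors. -/
theorem exists_boxProd_projections {x y : V × W} (p : (G □ H).Walk x y) :
    ∃ (a : G.Walk x.1 y.1) (b : H.Walk x.2 y.2), a.length + b.length = p.length ∧
      (∀ z ∈ p.support, z.1 ∈ a.support ∧ z.2 ∈ b.support) ∧
      (∀ u ∈ a.support, ∃ z ∈ p.support, z.1 = u) ∧
      (∀ v ∈ b.support, ∃ z ∈ p.support, z.2 = v) := by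
  induction p with
  | @nil x => exact ⟨(.nil : G.Walk x.1 x.1), (.nil : H.Walk x.2 x.2), by simp⟩
  | @cons x w y h p ih =>
    obtain ⟨a, b, hl, hs, ha, hb⟩ := ih
    obtain ⟨x₁, x₂⟩ := x
    obtain ⟨w₁, w₂⟩ := w
    rw [boxProd_adj] at h
    obtain ⟨h, rfl : x₂ = w₂⟩ | ⟨h, rfl : x₁ = w₁⟩ := h
    · refine ⟨.cons h a, b, ?_, ?_, ?_, ?_⟩
      · simp only [Walk.length_cons]; lia
      · simp only [Walk.support_cons, List.mem_cons]
        rintro z (rfl | hz)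
        · exact ⟨.inl rfl, b.start_mem_support⟩
        · exact ⟨.inr (hs z hz).1, (hs z hz).2⟩
      · simp only [Walk.support_cons, List.mem_cons]
        rintro u (rfl | hu)
        · exact ⟨_, .inl rfl, rfl⟩
        · obtain ⟨z, hz, rfl⟩ := ha u hu
          exact ⟨z, .inr hz, rfl⟩
      · intro v hv
        obtain ⟨z, hz, rfl⟩ := hb v hv
        exact ⟨z, by simp [hz], rfl⟩
    · refine ⟨a, .cons h b, ?_, ?_, ?_, ?_⟩
      · simp only [Walk.length_cons]; lia
      · simp only [Walk.support_cons, List.mem_cons]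
        rintro z (rfl | hz)
        · exact ⟨a.start_mem_support, .inl rfl⟩
        · exact ⟨(hs z hz).1, .inr (hs z hz).2⟩
      · intro u hu
        obtain ⟨z, hz, rfl⟩ := ha u hu
        exact ⟨z, by simp [hz], rfl⟩
      · simp only [Walk.support_cons, List.mem_cons]
        rintro v (rfl | hv)
        · exact ⟨_, .inl rfl, rfl⟩
        · obtain ⟨z, hz, rfl⟩ := hb v hv
          exact ⟨z, .inr hz, rfl⟩

@[simp]
theorem SimpleGraph.Walk.length_boxProdLeft {a a' : V} (b : W) (p : G.Walk a a') :
    (p.boxProdLeft H b).length = p.length :=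
  Walk.length_map _ p

@[simp]
theorem SimpleGraph.Walk.length_boxProdRight {b b' : W} (a : V) (p : H.Walk b b') :
    (p.boxProdRight G a).length = p.length :=
  Walk.length_map _ p

theorem SimpleGraph.Walk.support_boxProdLeft {a a' : V} (b : W) (p : G.Walk a a') :
    (p.boxProdLeft H b).support = p.support.map (·, b) :=
  Walk.support_map _ p

theorem SimpleGraph.Walk.support_boxProdRight {b b' : W} (a : V) (p : H.Walk b b') :
    (p.boxProdRight G a).support = p.support.map (a, ·) :=
  Walk.support_map _ p

theorem dist_boxProd_of_connected (hG : G.Connected) (hH : H.Connected) (x y : V × W) :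
    (G □ H).dist x y = G.dist x.1 y.1 + H.dist x.2 y.2 := by
  rw [SimpleGraph.dist, edist_boxProd, ENat.toNat_add]
  · rfl
  · exact edist_ne_top_iff_reachable.2 (hG _ _)
  · exact edist_ne_top_iff_reachable.2 (hH _ _)

theorem IsTotalMVSet.boxProd_fiber_right (hG : G.Connected) (hH : H.Connected)
    {X : Set (V × W)} (hX : IsTotalMVSet (G □ H) X) (a : V) :
    IsTotalMVSet H {b | (a, b) ∈ X} := by
  intro b b'
  obtain ⟨p, -, hd, hp⟩ := hX (a, b) (a, b')
  obtain ⟨q, r, hl, hs, -, hr⟩ := exists_boxProd_projections p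
  have hd' := dist_boxProd_of_connected hG hH (a, b) (a, b')
  simp only [dist_self, zero_add] at hd'
  have hrd : H.dist b b' ≤ r.length := dist_le r
  have hq : q.length = 0 := by lia
  have hrl : r.length = H.dist b b' := by lia
  refine ⟨r, r.isPath_of_length_eq_dist hrl, hrl, fun v hv hvX => ?_⟩
  obtain ⟨⟨u, v⟩, hz, rfl⟩ := hr v hv
  have hu : u = a := by
    simpa [Walk.nil_iff_support_eq.1 (Walk.length_eq_zero_iff.1 hq)] using (hs _ hz).1
  subst hu
  simpa using hp _ hz hvX

theorem IsTotalMVSet.boxProd_fiber_left (hG : G.Connected) (hH : H.Connected)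
    {X : Set (V × W)} (hX : IsTotalMVSet (G □ H) X) (b : W) :
    IsTotalMVSet G {a | (a, b) ∈ X} := by
  intro a a'
  obtain ⟨p, -, hd, hp⟩ := hX (a, b) (a', b)
  obtain ⟨q, r, hl, hs, hq, -⟩ := exists_boxProd_projections p
  have hd' := dist_boxProd_of_connected hG hH (a, b) (a', b)
  simp only [dist_self, add_zero] at hd'
  have hqd : G.dist a a' ≤ q.length := dist_le q
  have hr : r.length = 0 := by lia
  have hql : q.length = G.dist a a' := by lia
  refine ⟨q, q.isPath_of_length_eq_dist hql, hql, fun u hu huX => ?_⟩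
  obtain ⟨⟨u, v⟩, hz, rfl⟩ := hq u hu
  have hv : v = b := by
    simpa [Walk.nil_iff_support_eq.1 (Walk.length_eq_zero_iff.1 hr)] using (hs _ hz).2
  subst hv
  simpa using hp _ hz huX

/-- The vertices of `G` with at most one neighbour. -/
def endVertices (G : SimpleGraph V) : Set V :=
  {v | (G.neighborSet v).Subsingleton}

theorem SimpleGraph.Walk.IsPath.eq_or_eq_of_mem_endVertices {x y z : V} {p : G.Walk x y}
    (hp : p.IsPath) (hz : z ∈ p.support) (hzG : z ∈ endVertices G) : z = x ∨ z = y := by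
  induction p with
  | nil => simpa using hz
  | @cons x v y h p ih =>
    rw [Walk.cons_isPath_iff] at hp
    rw [Walk.support_cons, List.mem_cons] at hz
    obtain rfl | hz := hz
    · exact .inl rfl
    obtain rfl | rfl := ih hp.1 hz
    · cases p with
      | nil => exact .inr rfl
      | @cons _ w _ h' p =>
        obtain rfl : x = w := hzG h.symm h'
        exact absurd (by simp) hp.2
    · exact .inr rfl

theorem isTotalMVSet_endVertices (hG : G.Connected) : IsTotalMVSet G (endVertices G) :=
  fun x y => by
    obtain ⟨p, hp, hd⟩ := hG.exists_path_of_dist x y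
    exact ⟨p, hp, hd, fun z hz => hp.eq_or_eq_of_mem_endVertices hz⟩

theorem IsTotalMVSet.subset_endVertices (hG : G.IsAcyclic) {X : Set V}
    (hX : IsTotalMVSet G X) : X ⊆ endVertices G := by
  intro v hv a ha b hb
  by_contra hab
  rw [mem_neighborSet] at ha hb
  obtain ⟨p, hp, -, hpX⟩ := hX a b
  have hq : (Walk.cons ha.symm (.cons hb .nil)).IsPath := by
    simp [Walk.cons_isPath_iff, hab, ha.ne', hb.ne]
  have hpq := congrArg Subtype.val ((hG.subsingleton_path a b).elim ⟨p, hp⟩ ⟨_, hq⟩)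
  dsimp only at hpq
  obtain h | h := hpX v (by simp [hpq]) hv
  · exact ha.ne h
  · exact hb.ne h

theorem totalMVNum_eq_ncard_endVertices [Finite V] (hG : G.IsTree) :
    totalMVNum G = (endVertices G).ncard := by
  refine le_antisymm ?_ (isTotalMVSet_endVertices hG.connected).ncard_le_totalMVNum
  obtain ⟨X, hX, hXn⟩ := exists_isTotalMVSet_ncard_eq hG.connected
  rw [← hXn]
  exact Set.ncard_le_ncard (hX.subset_endVertices hG.isAcyclic)

theorem not_adj_of_mem_endVertices [Fintype V] (hG : G.Connected) (hV : 3 ≤ Fintype.card V)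
    {a b : V} (ha : a ∈ endVertices G) (hb : b ∈ endVertices G) : ¬ G.Adj a b := by
  classical
  intro hab
  have key : ∀ {x y : V}, G.Walk x y → x = a ∨ x = b → y = a ∨ y = b := by
    intro x y p
    induction p with
    | nil => exact id
    | cons h p ih =>
      rintro (rfl | rfl)
      · exact ih (.inr (ha h hab))
      · exact ih (.inl (hb h hab.symm))
  have hsub : (Finset.univ : Finset V) ⊆ {a, b} := fun x _ => by
    simpa using key (hG a x).some (.inl rfl)
  have := (Finset.card_le_card hsub).trans Finset.card_le_two
  rw [Finset.card_univ] at this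
  lia

theorem isTotalMVSet_endVertices_prod [Fintype V] (hG : G.Connected) (hH : H.Connected)
    (hV : 3 ≤ Fintype.card V) {Y : Set W} (hY : IsTotalMVSet H Y) :
    IsTotalMVSet (G □ H) (endVertices G ×ˢ Y) := by
  classical
  suffices ∀ x y : V × W, ∃ p : (G □ H).Walk x y, p.length = (G □ H).dist x y ∧
      ∀ z ∈ p.support, z ∈ endVertices G ×ˢ Y → z = x ∨ z = y from fun x y => by
    obtain ⟨p, hd, hp⟩ := this x y
    exact ⟨p, p.isPath_of_length_eq_dist hd, hd, hp⟩
  rintro ⟨a, b⟩ ⟨a', b'⟩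
  rw [dist_boxProd_of_connected hG hH]
  obtain ⟨r, -, hrd, hr⟩ := hY b b'
  obtain ⟨q, hq, hqd⟩ := hG.exists_path_of_dist a a'
  by_cases hs : ∃ s ∈ q.support, s ∉ endVertices G
  · obtain ⟨s, hs, hsG⟩ := hs
    have hl := congrArg Walk.length (q.take_spec hs)
    rw [Walk.length_append] at hl
    refine ⟨((q.takeUntil s hs).boxProdLeft H b).append
      ((r.boxProdRight G s).append ((q.dropUntil s hs).boxProdLeft H b')), ?_, ?_⟩
    · simp only [Walk.length_append, Walk.length_boxProdLeft, Walk.length_boxProdRight]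
      lia
    · rintro ⟨u, v⟩ hz ⟨hu : u ∈ endVertices G, -⟩
      have hus : u ≠ s := fun h => hsG (h ▸ hu)
      simp only [Walk.mem_support_append_iff, Walk.support_boxProdLeft,
        Walk.support_boxProdRight, List.mem_map] at hz
      obtain ⟨w, hw, hz⟩ | ⟨w, hw, hz⟩ | ⟨w, hw, hz⟩ := hz
      · obtain ⟨rfl, rfl⟩ : w = u ∧ b = v := Prod.ext_iff.1 hz
        have := (hq.takeUntil hs).eq_or_eq_of_mem_endVertices hw hu
        simp_all
      · exact absurd (congrArg Prod.fst hz).symm hus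
      · obtain ⟨rfl, rfl⟩ : w = u ∧ b' = v := Prod.ext_iff.1 hz
        have := (hq.dropUntil hs).eq_or_eq_of_mem_endVertices hw hu
        simp_all
  · push Not at hs
    cases q with
    | nil =>
      refine ⟨r.boxProdRight G a, by simpa using hrd, ?_⟩
      rintro ⟨u, v⟩ hz ⟨-, hv⟩
      simp only [Walk.support_boxProdRight, List.mem_map] at hz
      obtain ⟨w, hw, hz⟩ := hz
      obtain ⟨rfl, rfl⟩ : a = u ∧ w = v := Prod.ext_iff.1 hz
      simpa using hr w hw hv
    | cons h q =>
      exact absurd h (not_adj_of_mem_endVertices hG hV (hs _ (by simp)) (hs _ (by simp)))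

end

/-- If `T` is a tree with at least `3` vertices and `H` is a connected graph with at least
`2` vertices, then `μt(T □ H) = μt(T) · μt(H)`. -/
theorem totalMVNum_tree_boxProd {V W : Type*} [Fintype V] [Fintype W]
    (T : SimpleGraph V) (H : SimpleGraph W) (hT : T.IsTree) (hH : H.Connected)
    (hnV : 3 ≤ Fintype.card V) (hnW : 2 ≤ Fintype.card W) :
    totalMVNum (T □ H) = totalMVNum T * totalMVNum H := by
  classical
  rw [totalMVNum_eq_ncard_endVertices hT]
  apply le_antisymm
  · obtain ⟨X, hX, hXn⟩ := exists_isTotalMVSet_ncard_eq (hT.connected.boxProd hH)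
    rw [← hXn, Set.ncard_eq_toFinset_card' X, Set.ncard_eq_toFinset_card' (endVertices T),
      mul_comm]
    refine Finset.card_le_mul_card_image_of_maps_to (f := Prod.fst) ?_ _ fun a _ => ?_
    · rintro ⟨a, b⟩ hab
      rw [Set.mem_toFinset] at hab ⊢
      exact (hX.boxProd_fiber_left hT.connected hH b).subset_endVertices hT.isAcyclic hab
    · refine le_trans ?_ (hX.boxProd_fiber_right hT.connected hH a).ncard_le_totalMVNum
      rw [Set.ncard_eq_toFinset_card']
      refine Finset.card_le_card_of_injOn Prod.snd ?_ ?_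
      · rintro ⟨a', b⟩ h
        aesop
      · rintro ⟨a₁, b₁⟩ h₁ ⟨a₂, b₂⟩ h₂ h
        simp_all
  · obtain ⟨Y, hY, hYn⟩ := exists_isTotalMVSet_ncard_eq hH
    rw [← hYn, ← Set.ncard_prod]
    exact (isTotalMVSet_endVertices_prod hT.connected hH hnV hY).ncard_le_totalMVNum
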